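/- Consider the GREM with infinitely many levels determined by reals α_i > 1 with Σ_{i=1}^∞ log α_i = log 2 and variances a_i > 0 with Σ_{i=1}^∞ a_i = 1; for N ∈ ℕ let k_i(N) = ⌊N log α_i / log 2⌋ and α_N(β) = −E[log Z_{k(N)}(β)]. Then for every β > 0 the thermodynamic limit of the quenched free energy per site exists and is finite: −∞ < lim_{N→∞} ( −(1/(β|k(N)|)) E[log Z_{k(N)}(β)] ) = inf_{N} α_N(β)/(βN) < ∞. -/

import Mathlib

open MeasureTheory ProbabilityTheory

/-- `gremKnat n k j = k₁ + ⋯ + k_j`: the number of spin coordinates determined by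
the first `j` levels of the GREM tree (levels are indexed by `Fin n`, with the
level `i : Fin n` being the `(i+1)`-st level). -/
def gremKnat (n : ℕ) (k : Fin n → ℕ) (j : ℕ) : ℕ :=
  ∑ i ∈ Finset.univ.filter (fun i : Fin n => (i : ℕ) < j), k i

/-- The sample space of the GREM: one Gaussian variable `ε_i^{(s)}` for each level
`i` and each string `s ∈ {−1,1}^{K_i}` (encoded as `Fin K_i → Bool`). -/
abbrev GremSample (n : ℕ) (k : Fin n → ℕ) : Type :=
  (i : Fin n) → ((Fin (gremKnat n k ((i : ℕ) + 1)) → Bool) → ℝ)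

/-- The law of the disorder of the GREM: the `ε_i^{(s)}` are independent centered
Gaussians with variance `a_i`. -/
noncomputable def gremMeasure (n : ℕ) (k : Fin n → ℕ) (a : Fin n → ℝ) :
    Measure (GremSample n k) :=
  Measure.pi fun i => Measure.pi fun _ => gaussianReal 0 (a i).toNNReal

/-- The GREM Hamiltonian `H_k(σ) = −√|k| Σ_{i : k_i > 0} ε_i^{(σ↾K_i)}`,
where `σ↾K_i` is the restriction of `σ` to its first `K_i` coordinates. -/
noncomputable def gremH (n : ℕ) (k : Fin n → ℕ) (ω : GremSample n k)
    (σ : Fin (∑ j, k j) → Bool) : ℝ :=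
  -Real.sqrt (∑ j, k j) *
    ∑ i ∈ Finset.univ.filter (fun i : Fin n => 0 < k i),
      ω i (fun t => σ (Fin.castLE
        (by exact Finset.sum_le_sum_of_subset (Finset.filter_subset _ _)) t))

/-- The GREM partition function `Z_k(β) = Σ_{σ ∈ {−1,1}^{|k|}} exp(−β H_k(σ))`. -/
noncomputable def gremZ (n : ℕ) (k : Fin n → ℕ) (β : ℝ) (ω : GremSample n k) : ℝ :=
  ∑ σ : Fin (∑ j, k j) → Bool, Real.exp (-β * gremH n k ω σ)

/-- `k_i(N) = ⌊N log α_i / log 2⌋` for the GREM with infinitely many levels. -/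
noncomputable def gremSeqK (alpha : ℕ → ℝ) (N i : ℕ) : ℕ :=
  ⌊(N : ℝ) * Real.log (alpha i) / Real.log 2⌋₊

/-- `n(N)`: the number of levels of the `N`-th model, i.e. (the index of) the
largest level with `k_i(N) > 0`. -/
noncomputable def gremSeqLevels (alpha : ℕ → ℝ) (N : ℕ) : ℕ :=
  sSup {i : ℕ | 0 < gremSeqK alpha N i} + 1

/-- `α_N(β) = −E[log Z_{k(N)}(β)]` for the GREM with infinitely many levels. -/
noncomputable def gremSeqAlpha (alpha a : ℕ → ℝ) (β : ℝ) (N : ℕ) : ℝ :=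
  -∫ ω, Real.log (gremZ (gremSeqLevels alpha N)
        (fun i => gremSeqK alpha N (i : ℕ)) β ω)
    ∂(gremMeasure (gremSeqLevels alpha N)
        (fun i => gremSeqK alpha N (i : ℕ)) (fun i => a (i : ℕ)))

/-- `|k(N)| = Σᵢ k_i(N)` (as a real number; only finitely many terms are
nonzero). -/
noncomputable def gremSeqKtot (alpha : ℕ → ℝ) (N : ℕ) : ℝ :=
  ∑' i, (gremSeqK alpha N i : ℝ)

open scoped NNReal
open Filter Topology

namespace Grem

section Law

variable {S T I : Type*}

lemma measurable_comp_label (f : S → T) : Measurable (fun (g : T → ℝ) s => g (f s)) :=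
  measurable_pi_lambda _ fun _ => measurable_pi_apply _

variable [Fintype T] [Fintype I]

/-- The law of the field `s ↦ g (f s)`, where the `g t` are independent centered Gaussians of
variance `v`. -/
noncomputable def labelLaw (f : S → T) (v : ℝ≥0) : Measure (S → ℝ) :=
  (Measure.pi fun _ : T => gaussianReal 0 v).map (fun g s => g (f s))

instance (f : S → T) (v : ℝ≥0) : IsProbabilityMeasure (labelLaw f v) :=
  Measure.isProbabilityMeasure_map (measurable_comp_label f).aemeasurable

lemma map_pi_comp_injective {e : I → T} (he : Function.Injective e) (v : ℝ≥0) :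
    (Measure.pi fun _ : T => gaussianReal 0 v).map (fun g i => g (e i)) =
      Measure.pi fun _ : I => gaussianReal 0 v := by
  have h := (iIndepFun_pi (μ := fun _ : T => gaussianReal 0 v) (X := fun _ x => x)
    (fun _ => aemeasurable_id)).precomp he
  have h2 := h.map_fun_eq_pi_map (fun i => (measurable_pi_apply (e i)).aemeasurable)
  refine h2.trans ?_
  congr 1
  funext i
  exact (measurePreserving_eval (fun _ : T => gaussianReal 0 v) (e i)).map_eq

lemma labelLaw_comp_injective (f : S → I) {e : I → T} (he : Function.Injective e) (v : ℝ≥0) :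
    labelLaw (fun s => e (f s)) v = labelLaw f v := by
  rw [labelLaw, labelLaw, ← map_pi_comp_injective he, Measure.map_map (measurable_comp_label f)
    (measurable_comp_label e)]
  rfl

/-- The law of a field depends on its labelling only through the partition into level sets. -/
lemma labelLaw_congr {f : S → T} {f' : S → I} (h : ∀ s t, f s = f t ↔ f' s = f' t) (v : ℝ≥0) :
    labelLaw f v = labelLaw f' v := by
  classical
  have hf : labelLaw f v = labelLaw (Set.rangeFactorization f) v :=
    labelLaw_comp_injective (Set.rangeFactorization f) Subtype.val_injective v
  rw [hf]
  have hsurj := Set.rangeFactorization_surjective (f := f)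
  let e : Set.range f → I := fun t => f' (Function.surjInv hsurj t)
  have he : ∀ s, e (Set.rangeFactorization f s) = f' s := fun s => by
    refine (h _ _).1 ?_
    exact congrArg Subtype.val (Function.surjInv_eq hsurj (Set.rangeFactorization f s))
  have hinj : Function.Injective e := by
    intro t t' ht
    have := (h _ _).2 ht
    have h2 := Subtype.ext (a1 := Set.rangeFactorization f (Function.surjInv hsurj t))
      (a2 := Set.rangeFactorization f (Function.surjInv hsurj t')) this
    rwa [Function.surjInv_eq hsurj, Function.surjInv_eq hsurj] at h2
  rw [← labelLaw_comp_injective (Set.rangeFactorization f) hinj]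
  simp only [he]

lemma labelLaw_zero (f : S → T) : labelLaw f 0 = Measure.dirac 0 := by
  rw [labelLaw]
  simp only [gaussianReal_zero_var]
  have h := Measure.pi_map_pi (ι := T) (μ := fun _ => gaussianReal 0 0) (f := fun _ _ => (0 : ℝ))
    (hμ := fun _ => by rw [Measure.map_const]; simp; infer_instance) (fun _ => by fun_prop)
  simp only [Measure.map_const, measure_univ, one_smul] at h
  rw [← h, Measure.map_dirac' (measurable_comp_label f)]
  rfl

/-- The convolution of `μ 0, …, μ (n - 1)`. -/
noncomputable def convSeq {E : Type*} [AddMonoid E] [MeasurableSpace E] (μ : ℕ → Measure E) :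
    ℕ → Measure E
  | 0 => Measure.dirac 0
  | n + 1 => convSeq μ n ∗ μ n

lemma integrable_conv {E : Type*} [NormedAddCommGroup E] [MeasurableSpace E] [BorelSpace E]
    [SecondCountableTopology E] {μ ν : Measure E} [IsProbabilityMeasure μ] [IsProbabilityMeasure ν]
    (hμ : Integrable (fun x => x) μ) (hν : Integrable (fun x => x) ν) :
    Integrable (fun x => x) (μ ∗ ν) := by
  rw [Measure.conv, integrable_map_measure (by fun_prop) (by fun_prop)]
  exact (hμ.comp_fst ν).add (hν.comp_snd μ)

variable [Fintype S]

/-- The log-partition function of a field of exponents. -/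
noncomputable def logSumExp (x : S → ℝ) : ℝ := Real.log (∑ s, Real.exp (x s))

/-- Comparison of the expected log-partition functions of two fields, in every external field. -/
def LseLE (μ ν : Measure (S → ℝ)) : Prop :=
  ∀ h : S → ℝ, ∫ x, logSumExp (h + x) ∂μ ≤ ∫ x, logSumExp (h + x) ∂ν

lemma sum_exp_pos [Nonempty S] (x : S → ℝ) : 0 < ∑ s, Real.exp (x s) :=
  Finset.sum_pos (fun _ _ => Real.exp_pos _) Finset.univ_nonempty

lemma continuous_logSumExp [Nonempty S] : Continuous (logSumExp : (S → ℝ) → ℝ) :=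
  Continuous.log (by fun_prop) fun x => (sum_exp_pos x).ne'

lemma aestronglyMeasurable_logSumExp [Nonempty S] (h : S → ℝ) (μ : Measure (S → ℝ)) :
    AEStronglyMeasurable (fun x => logSumExp (h + x)) μ :=
  (continuous_logSumExp.comp (by fun_prop : Continuous fun x => h + x)).aestronglyMeasurable

lemma abs_logSumExp_le [Nonempty S] (x : S → ℝ) :
    |logSumExp x| ≤ Real.log (Fintype.card S) + ‖x‖ := by
  have hx : ∀ s, |x s| ≤ ‖x‖ := fun s => norm_le_pi_norm x s
  have hc : (1 : ℝ) ≤ Fintype.card S := by exact_mod_cast Fintype.card_pos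
  have hl := Real.log_nonneg hc
  have h1 : ∑ s, Real.exp (x s) ≤ Fintype.card S * Real.exp ‖x‖ := by
    calc ∑ s, Real.exp (x s) ≤ ∑ _s : S, Real.exp ‖x‖ :=
          Finset.sum_le_sum fun s _ => Real.exp_le_exp.2 ((le_abs_self _).trans (hx s))
      _ = _ := by simp
  have h2 : Fintype.card S * Real.exp (-‖x‖) ≤ ∑ s, Real.exp (x s) := by
    calc Fintype.card S * Real.exp (-‖x‖) = ∑ _s : S, Real.exp (-‖x‖) := by simp
      _ ≤ _ := Finset.sum_le_sum fun s _ => Real.exp_le_exp.2 (neg_le_of_abs_le (hx s))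
  have h3 := Real.log_le_log (sum_exp_pos x) h1
  have h4 := Real.log_le_log (by positivity) h2
  rw [Real.log_mul (by positivity) (by positivity), Real.log_exp] at h3 h4
  unfold logSumExp
  rw [abs_le]
  constructor <;> linarith

lemma integrable_logSumExp [Nonempty S] {μ : Measure (S → ℝ)} [IsProbabilityMeasure μ]
    (hμ : Integrable (fun x => x) μ) (h : S → ℝ) :
    Integrable (fun x => logSumExp (h + x)) μ := by
  refine Integrable.mono' (g := fun x => Real.log (Fintype.card S) + ‖h‖ + ‖x‖)
    ((integrable_const _).add hμ.norm)
    (aestronglyMeasurable_logSumExp h μ) (.of_forall fun x => ?_)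
  have := abs_logSumExp_le (h + x)
  have := norm_add_le h x
  rw [Real.norm_eq_abs]
  linarith

lemma logSumExp_add_const [Nonempty S] (x : S → ℝ) (c : ℝ) :
    logSumExp (x + fun _ => c) = logSumExp x + c := by
  simp only [logSumExp, Pi.add_apply, Real.exp_add, ← Finset.sum_mul]
  rw [Real.log_mul (sum_exp_pos x).ne' (Real.exp_pos _).ne', Real.log_exp]

lemma integrable_labelLaw (f : S → T) (v : ℝ≥0) : Integrable (fun x => x) (labelLaw f v) := by
  rw [labelLaw, integrable_map_measure (by fun_prop) (measurable_comp_label f).aemeasurable]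
  refine Integrable.of_eval fun s => ?_
  have h : Integrable (fun x : ℝ => x) (gaussianReal 0 v) :=
    (memLp_id_gaussianReal' 1 (by simp)).integrable (by simp)
  exact (measurePreserving_eval (fun _ : T => gaussianReal 0 v) (f s)).integrable_comp_of_integrable
    h

/-- A product of probability weights has the given weights as marginals. -/
lemma sum_prod_weights_mul [DecidableEq I] {p : I → S → ℝ} (hp : ∀ i, ∑ s, p i s = 1) (i₀ : I)
    (F : S → ℝ) : ∑ J : I → S, (∏ i, p i (J i)) * F (J i₀) = ∑ s, p i₀ s * F s := by
  have h := Finset.prod_univ_sum (fun _ : I => (Finset.univ : Finset S))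
    (fun i s => p i s * if i = i₀ then F s else 1)
  rw [Fintype.piFinset_univ] at h
  have h1 : ∀ J : I → S, ∏ i, (p i (J i) * if i = i₀ then F (J i) else 1) =
      (∏ i, p i (J i)) * F (J i₀) := fun J => by
    rw [Finset.prod_mul_distrib]
    simp
  simp only [h1] at h
  rw [← h, Finset.prod_eq_single i₀]
  · simp
  · intro i _ hi
    simp [hi, hp]
  · simp

/-- Resampling within the blocks of a partition `q`: choosing in each block `i` a random
representative `J i` with the Gibbs weights decreases the log-partition function on average. -/
lemma exists_resampling_weights [DecidableEq I] [Nonempty S] (h : S → ℝ) {q : S → I}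
    (hq : Function.Surjective q) :
    ∃ P : (I → S) → ℝ, (∀ J, 0 ≤ P J) ∧ ∑ J, P J = 1 ∧ (∀ J, P J ≠ 0 → ∀ i, q (J i) = i) ∧
      ∀ y : S → ℝ, ∑ J, P J * logSumExp (h + fun s => y (J (q s))) ≤ logSumExp (h + y) := by
  classical
  let W : I → ℝ := fun i => ∑ s, if q s = i then Real.exp (h s) else 0
  have hW : ∀ i, 0 < W i := fun i => by
    obtain ⟨s, rfl⟩ := hq i
    refine Finset.sum_pos' (fun t _ => by positivity) ⟨s, Finset.mem_univ _, ?_⟩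
    simp [Real.exp_pos]
  let p : I → S → ℝ := fun i s => if q s = i then Real.exp (h s) / W i else 0
  have hp0 : ∀ i s, 0 ≤ p i s := fun i s => by
    have := hW i
    simp only [p]
    positivity
  have hp1 : ∀ i, ∑ s, p i s = 1 := fun i => by
    have : ∀ s, p i s = (if q s = i then Real.exp (h s) else 0) / W i := fun s => by
      simp only [p]; split_ifs <;> simp
    simp only [this, ← Finset.sum_div]
    exact div_self (hW i).ne'
  have hP0 : ∀ J : I → S, 0 ≤ ∏ i, p i (J i) := fun J => Finset.prod_nonneg fun i _ => hp0 _ _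
  have hP1 : ∑ J : I → S, ∏ i, p i (J i) = 1 := by
    have h := Finset.prod_univ_sum (fun _ : I => (Finset.univ : Finset S)) p
    rw [Fintype.piFinset_univ] at h
    rw [← h]
    simp [hp1]
  refine ⟨fun J => ∏ i, p i (J i), hP0, hP1, fun J hJ i => ?_, fun y => ?_⟩
  · have := Finset.prod_ne_zero_iff.1 hJ i (Finset.mem_univ i)
    by_contra hne
    simp [p, hne] at this
  have hconc := strictConcaveOn_log_Ioi.concaveOn.le_map_sum (t := Finset.univ)
    (w := fun J : I → S => ∏ i, p i (J i))
    (p := fun J => ∑ s, Real.exp (h s + y (J (q s)))) (fun J _ => hP0 J) hP1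
    (fun J _ => sum_exp_pos (fun s => h s + y (J (q s))))
  refine hconc.trans_eq ?_
  rw [logSumExp]
  congr 1
  simp only [smul_eq_mul, Finset.mul_sum, Pi.add_apply, Real.exp_add]
  rw [Finset.sum_comm]
  have hmarg : ∀ s, ∑ J : I → S, (∏ i, p i (J i)) * (Real.exp (h s) * Real.exp (y (J (q s)))) =
      ∑ t, Real.exp (h t) * Real.exp (y t) * p (q t) s := fun s => by
    have := sum_prod_weights_mul hp1 (q s) (fun t => Real.exp (h s) * Real.exp (y t))
    rw [this]
    refine Finset.sum_congr rfl fun t _ => ?_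
    by_cases hst : q t = q s
    · simp only [p, hst, if_true]
      ring
    · simp [p, hst, Ne.symm hst]
  simp only [hmarg]
  rw [Finset.sum_comm]
  simp [← Finset.mul_sum, hp1]

/-- Merging labels, i.e. making a field more correlated while keeping the variances, decreases
the expected log-partition function. -/
lemma labelLaw_merge [Nonempty S] (f : S → T) (q : S → I)
    (hfq : ∀ s t, f s = f t → q s = q t) (v : ℝ≥0) :
    LseLE (labelLaw q v) (labelLaw f v) := by
  classical
  intro h
  have hrange : labelLaw q v = labelLaw (Set.rangeFactorization q) v :=
    labelLaw_comp_injective (Set.rangeFactorization q) Subtype.val_injective v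
  rw [hrange]
  have hsurj := Set.rangeFactorization_surjective (f := q)
  have hfq' : ∀ s t, f s = f t → Set.rangeFactorization q s = Set.rangeFactorization q t :=
    fun s t hst => Subtype.ext (hfq s t hst)
  generalize Set.rangeFactorization q = r at hsurj hfq'
  obtain ⟨P, hP0, hP1, hPq, hP⟩ := exists_resampling_weights h hsurj
  let γ : Measure (T → ℝ) := Measure.pi fun _ : T => gaussianReal 0 v
  have hint : ∀ {J : Type _} [Fintype J] (p : S → J),
      Integrable (fun x => logSumExp (h + x)) (labelLaw p v) := fun p =>
    integrable_logSumExp (integrable_labelLaw p v) h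
  have hlaw : ∀ p : S → T, ∫ x, logSumExp (h + x) ∂(labelLaw p v) =
      ∫ g, logSumExp (h + fun s => g (p s)) ∂γ := fun p => by
    rw [labelLaw, integral_map (measurable_comp_label p).aemeasurable
      (aestronglyMeasurable_logSumExp h _)]
  have hintγ : ∀ p : S → T, Integrable (fun g => logSumExp (h + fun s => g (p s))) γ := fun p =>
    (integrable_map_measure (aestronglyMeasurable_logSumExp h _)
      (measurable_comp_label p).aemeasurable).1 (hint p)
  rw [hlaw f]
  calc ∫ x, logSumExp (h + x) ∂(labelLaw r v)
      = ∑ J, P J * ∫ x, logSumExp (h + x) ∂(labelLaw r v) := by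
        rw [← Finset.sum_mul, hP1, one_mul]
    _ = ∑ J, P J * ∫ g, logSumExp (h + fun s => g (f (J (r s)))) ∂γ := by
        refine Finset.sum_congr rfl fun J _ => ?_
        by_cases hJ : P J = 0
        · simp [hJ]
        have hinj : Function.Injective (fun i => f (J i)) := fun i j hij => by
          have := hfq' _ _ hij
          rwa [hPq J hJ, hPq J hJ] at this
        rw [← hlaw (fun s => f (J (r s))), labelLaw_comp_injective r hinj]
    _ = ∫ g, ∑ J, P J * logSumExp (h + fun s => g (f (J (r s)))) ∂γ := by
        rw [integral_finsetSum _ fun J _ => (hintγ fun s => f (J (r s))).const_mul _]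
        simp only [integral_const_mul]
    _ ≤ _ := by
        refine integral_mono
          (integrable_finsetSum _ fun J _ => (hintγ fun s => f (J (r s))).const_mul _)
          (hintγ f) fun g => ?_
        exact hP fun s => g (f s)

lemma integral_logSumExp_const_label [Nonempty S] (h : S → ℝ) (v : ℝ≥0) :
    ∫ x, logSumExp (h + x) ∂(labelLaw (fun _ : S => ()) v) = logSumExp h := by
  rw [labelLaw, integral_map (measurable_comp_label _).aemeasurable
    (aestronglyMeasurable_logSumExp h _)]
  simp only [logSumExp_add_const]
  have h0 : Integrable (fun x : ℝ => x) (gaussianReal 0 v) :=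
    (memLp_id_gaussianReal' 1 (by simp)).integrable (by simp)
  have hp := measurePreserving_eval (fun _ : Unit => gaussianReal 0 v) ()
  have h1 : Integrable (fun g : Unit → ℝ => g ()) (Measure.pi fun _ => gaussianReal 0 v) :=
    hp.integrable_comp_of_integrable h0
  have h2 : ∫ g : Unit → ℝ, g () ∂(Measure.pi fun _ => gaussianReal 0 v) = 0 := by
    have := integral_map (μ := Measure.pi fun _ : Unit => gaussianReal 0 v)
      hp.measurable.aemeasurable (f := fun x : ℝ => x) (by fun_prop)
    rw [hp.map_eq, integral_id_gaussianReal] at this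
    exact this.symm
  rw [integral_add (integrable_const _) h1, h2]
  simp

lemma dirac_lseLE_labelLaw [Nonempty S] (f : S → T) (v : ℝ≥0) :
    LseLE (Measure.dirac 0) (labelLaw f v) := by
  intro h
  have h1 := labelLaw_merge f (fun _ => ()) (fun _ _ _ => rfl) v h
  rw [integral_logSumExp_const_label] at h1
  rwa [integral_dirac, add_zero]

lemma integral_logSumExp_labelLaw_le [Nonempty S] (h : S → ℝ) (f : S → T) (v : ℝ≥0) :
    ∫ x, logSumExp (h + x) ∂(labelLaw f v) ≤ logSumExp h + v / 2 := by
  have hexp : ∀ s, ∫ x, Real.exp (x s) ∂(labelLaw f v) = Real.exp (v / 2) ∧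
      Integrable (fun x => Real.exp (x s)) (labelLaw f v) := fun s => by
    have hp : (labelLaw f v).map (fun x => x s) = gaussianReal 0 v := by
      rw [labelLaw, Measure.map_map (measurable_pi_apply s) (measurable_comp_label f)]
      exact (measurePreserving_eval (fun _ : T => gaussianReal 0 v) (f s)).map_eq
    have hm := mgf_gaussianReal hp 1
    have hi := integrable_exp_mul_gaussianReal (μ := 0) (v := v) 1
    rw [← hp] at hi
    replace hi := (integrable_map_measure (f := fun x : S → ℝ => x s) hi.aestronglyMeasurable
      (measurable_pi_apply s).aemeasurable).1 hi
    constructor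
    · simpa [mgf] using hm
    · simpa [Function.comp_def] using hi
  let A := ∑ s, Real.exp (h s)
  have hA : 0 < A := sum_exp_pos h
  have hB : 0 < A * Real.exp (v / 2) := by positivity
  have hbound : ∀ x, logSumExp (h + x) ≤ Real.log (A * Real.exp (v / 2)) +
      ((∑ s, Real.exp (h s) * Real.exp (x s)) / (A * Real.exp (v / 2)) - 1) := fun x => by
    have hx := sum_exp_pos (h + x)
    have := Real.log_le_sub_one_of_pos (div_pos hx hB)
    rw [Real.log_div hx.ne' hB.ne'] at this
    simp only [Pi.add_apply, Real.exp_add] at this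
    simp only [logSumExp, Pi.add_apply, Real.exp_add]
    linarith
  have hisum : Integrable (fun x => ∑ s, Real.exp (h s) * Real.exp (x s)) (labelLaw f v) :=
    integrable_finsetSum _ fun s _ => (hexp s).2.const_mul _
  have hsub : Integrable (fun x => (∑ s, Real.exp (h s) * Real.exp (x s)) /
      (A * Real.exp (v / 2)) - 1) (labelLaw f v) := (hisum.div_const _).sub (integrable_const _)
  calc ∫ x, logSumExp (h + x) ∂(labelLaw f v)
      ≤ ∫ x, (Real.log (A * Real.exp (v / 2)) +
      ((∑ s, Real.exp (h s) * Real.exp (x s)) / (A * Real.exp (v / 2)) - 1)) ∂(labelLaw f v) :=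
        integral_mono (integrable_logSumExp (integrable_labelLaw f v) h)
          ((integrable_const _).add hsub) hbound
    _ = Real.log (A * Real.exp (v / 2)) + ((∑ s, Real.exp (h s) * Real.exp (v / 2)) /
          (A * Real.exp (v / 2)) - 1) := by
        rw [integral_add (integrable_const _) hsub, integral_sub (hisum.div_const _)
          (integrable_const _), integral_div, integral_finsetSum _ fun s _ =>
          (hexp s).2.const_mul _]
        simp [integral_const_mul, (hexp _).1]
    _ = logSumExp h + v / 2 := by
        rw [← Finset.sum_mul, div_self hB.ne', Real.log_mul hA.ne' (Real.exp_pos _).ne',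
          Real.log_exp]
        simp [A, logSumExp]

end Law

section Convolution

variable {E : Type*} [AddCommMonoid E] [MeasurableSpace E] [MeasurableAdd₂ E]

instance (μ : ℕ → Measure E) [∀ i, IsProbabilityMeasure (μ i)] (n : ℕ) :
    IsProbabilityMeasure (convSeq μ n) := by
  induction n with
  | zero => exact Measure.dirac.isProbabilityMeasure
  | succ n ih => rw [convSeq]; infer_instance

lemma convSeq_conv (μ ν : ℕ → Measure E) [∀ i, IsProbabilityMeasure (μ i)]
    [∀ i, IsProbabilityMeasure (ν i)] (n : ℕ) :
    convSeq (fun i => μ i ∗ ν i) n = convSeq μ n ∗ convSeq ν n := by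
  induction n with
  | zero => simp [convSeq]
  | succ n ih =>
    simp only [convSeq]
    rw [ih, Measure.conv_assoc, Measure.conv_assoc, ← Measure.conv_assoc (convSeq ν n),
      Measure.conv_comm (convSeq ν n) (μ n), Measure.conv_assoc (μ n)]

lemma map_convSeq {F : Type*} [AddCommMonoid F] [MeasurableSpace F] [MeasurableAdd₂ F]
    (μ : ℕ → Measure E) [∀ i, IsProbabilityMeasure (μ i)] (L : E →+ F) (hL : Measurable L)
    (n : ℕ) : (convSeq μ n).map L = convSeq (fun i => (μ i).map L) n := by
  induction n with
  | zero => simp [convSeq, Measure.map_dirac' hL]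
  | succ n ih => simp only [convSeq]; rw [Measure.map_conv_addMonoidHom L hL, ih]

lemma convSeq_eq_of_le (μ : ℕ → Measure E) [∀ i, IsProbabilityMeasure (μ i)] {m n : ℕ}
    (hmn : m ≤ n) (h : ∀ i, m ≤ i → μ i = Measure.dirac 0) : convSeq μ n = convSeq μ m := by
  induction n, hmn using Nat.le_induction with
  | base => rfl
  | succ n hn ih => rw [convSeq, h n hn, Measure.conv_dirac_zero, ih]

lemma map_sum_pi (μ : ℕ → Measure E) [∀ i, IsProbabilityMeasure (μ i)] (n : ℕ) :
    (Measure.pi fun i : Fin n => μ i).map (fun x => ∑ i, x i) = convSeq μ n := by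
  induction n with
  | zero => simp [convSeq, Measure.map_const]
  | succ n ih =>
    have h := measurePreserving_piFinSuccAbove (fun i : Fin (n + 1) => μ i) (Fin.last n)
    have hf : (fun x : Fin (n + 1) → E => ∑ i, x i) =
        (fun p : E × E => p.1 + p.2) ∘ Prod.map id (fun x : Fin n → E => ∑ i, x i) ∘
          MeasurableEquiv.piFinSuccAbove (fun _ => E) (Fin.last n) := by
      funext x
      simp [Fin.sum_univ_castSucc, MeasurableEquiv.piFinSuccAbove, add_comm, Fin.init]
    have hs : Measurable (fun x : Fin n → E => ∑ i, x i) := by fun_prop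
    rw [hf, ← Measure.map_map (by fun_prop) ((measurable_id.prodMap hs).comp h.measurable),
      ← Measure.map_map (measurable_id.prodMap hs) h.measurable, h.map_eq,
      ← Measure.map_prod_map _ _ measurable_id hs, Measure.map_id]
    simp only [Fin.succAbove_last, Fin.val_last, Fin.val_castSucc]
    rw [ih, convSeq, Measure.conv_comm]
    rfl

end Convolution

section Comparison

variable {S T I : Type*} [Fintype T] [Fintype I]

lemma labelLaw_add (f : S → T) (v w : ℝ≥0) :
    labelLaw f (v + w) = labelLaw f v ∗ labelLaw f w := by
  have h1 : (Measure.pi fun _ : T => gaussianReal 0 (v + w)) =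
      (Measure.pi fun _ : T => gaussianReal 0 v) ∗ Measure.pi fun _ : T => gaussianReal 0 w := by
    have hc : gaussianReal 0 (v + w) = gaussianReal 0 v ∗ gaussianReal 0 w := by
      rw [gaussianReal_conv_gaussianReal, add_zero]
    have hp := measurePreserving_arrowProdEquivProdArrow ℝ ℝ T (fun _ => gaussianReal 0 v)
      (fun _ => gaussianReal 0 w)
    rw [hc, Measure.conv, Measure.conv, ← hp.map_eq, Measure.map_map (by fun_prop) hp.measurable]
    have hprob : ∀ _ : T, IsProbabilityMeasure (((gaussianReal 0 v).prod (gaussianReal 0 w)).map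
        fun p : ℝ × ℝ => p.1 + p.2) := fun _ =>
      Measure.isProbabilityMeasure_map (by fun_prop)
    exact (Measure.pi_map_pi (fun _ => by fun_prop)).symm
  let L : (T → ℝ) →+ (S → ℝ) :=
    { toFun := fun g s => g (f s), map_zero' := rfl, map_add' := fun _ _ => rfl }
  have h2 := Measure.map_conv_addMonoidHom (μ := Measure.pi fun _ : T => gaussianReal 0 v)
    (ν := Measure.pi fun _ : T => gaussianReal 0 w) L (measurable_comp_label f)
  rw [← h1] at h2
  exact h2

lemma map_labelLaw_comp {R : Type*} (f : S → T) (r : R → S) (v : ℝ≥0) :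
    (labelLaw f v).map (fun x s => x (r s)) = labelLaw (fun s => f (r s)) v := by
  rw [labelLaw, Measure.map_map (measurable_comp_label r) (measurable_comp_label f)]
  rfl

variable [Fintype S]

lemma LseLE.trans {μ ν ρ : Measure (S → ℝ)} (h : LseLE μ ν) (h' : LseLE ν ρ) : LseLE μ ρ :=
  fun k => (h k).trans (h' k)

lemma integrable_convSeq {μ : ℕ → Measure (S → ℝ)} [∀ i, IsProbabilityMeasure (μ i)]
    (hμ : ∀ i, Integrable (fun x => x) (μ i)) (n : ℕ) :
    Integrable (fun x => x) (convSeq μ n) := by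
  induction n with
  | zero => exact integrable_dirac (by simp)
  | succ n ih => exact integrable_conv ih (hμ n)

variable [Nonempty S]

lemma integral_logSumExp_conv {μ ν : Measure (S → ℝ)} [IsProbabilityMeasure μ]
    [IsProbabilityMeasure ν] (hμ : Integrable (fun x => x) μ) (hν : Integrable (fun x => x) ν)
    (h : S → ℝ) : ∫ x, logSumExp (h + x) ∂(μ ∗ ν) =
      ∫ x, ∫ y, logSumExp (h + x + y) ∂ν ∂μ := by
  rw [integral_conv (integrable_logSumExp (integrable_conv hμ hν) h)]
  simp only [add_assoc]

lemma integrable_integral_logSumExp {μ ν : Measure (S → ℝ)} [IsProbabilityMeasure μ]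
    [IsProbabilityMeasure ν] (hμ : Integrable (fun x => x) μ) (hν : Integrable (fun x => x) ν)
    (h : S → ℝ) : Integrable (fun x => ∫ y, logSumExp (h + x + y) ∂ν) μ := by
  have hi := integrable_logSumExp (integrable_conv hμ hν) h
  rw [Measure.conv, integrable_map_measure (aestronglyMeasurable_logSumExp h _)
    (by fun_prop)] at hi
  have := hi.integral_prod_left
  simpa only [Function.comp_def, ← add_assoc] using this

lemma LseLE.conv_left {μ ν ν' : Measure (S → ℝ)} [IsProbabilityMeasure μ]
    [IsProbabilityMeasure ν] [IsProbabilityMeasure ν'] (hμ : Integrable (fun x => x) μ)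
    (hν : Integrable (fun x => x) ν) (hν' : Integrable (fun x => x) ν') (h : LseLE ν ν') :
    LseLE (μ ∗ ν) (μ ∗ ν') := fun k => by
  rw [integral_logSumExp_conv hμ hν, integral_logSumExp_conv hμ hν']
  exact integral_mono (integrable_integral_logSumExp hμ hν k)
    (integrable_integral_logSumExp hμ hν' k) fun x => h (k + x)

lemma LseLE.conv {μ μ' ν ν' : Measure (S → ℝ)} [IsProbabilityMeasure μ]
    [IsProbabilityMeasure μ'] [IsProbabilityMeasure ν] [IsProbabilityMeasure ν']
    (hμ : Integrable (fun x => x) μ) (hμ' : Integrable (fun x => x) μ')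
    (hν : Integrable (fun x => x) ν) (hν' : Integrable (fun x => x) ν')
    (h : LseLE μ μ') (h' : LseLE ν ν') : LseLE (μ ∗ ν) (μ' ∗ ν') := by
  refine (h'.conv_left hμ hν hν').trans ?_
  rw [Measure.conv_comm μ, Measure.conv_comm μ']
  exact h.conv_left hν' hμ hμ'

lemma labelLaw_mono (f : S → T) {v w : ℝ≥0} (hvw : v ≤ w) :
    LseLE (labelLaw f v) (labelLaw f w) := by
  obtain ⟨u, rfl⟩ := exists_add_of_le hvw
  have h := (dirac_lseLE_labelLaw f u).conv_left (integrable_labelLaw f v)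
    (integrable_dirac (by simp)) (integrable_labelLaw f u)
  rwa [Measure.conv_dirac_zero, ← labelLaw_add] at h

lemma convSeq_lseLE {μ ν : ℕ → Measure (S → ℝ)} [∀ i, IsProbabilityMeasure (μ i)]
    [∀ i, IsProbabilityMeasure (ν i)] (hμ : ∀ i, Integrable (fun x => x) (μ i))
    (hν : ∀ i, Integrable (fun x => x) (ν i)) (h : ∀ i, LseLE (μ i) (ν i)) (n : ℕ) :
    LseLE (convSeq μ n) (convSeq ν n) := by
  induction n with
  | zero => exact fun _ => le_rfl
  | succ n ih =>
    exact ih.conv (integrable_convSeq hμ n) (integrable_convSeq hν n) (hμ n) (hν n) (h n)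

lemma integral_logSumExp_convSeq_le (f : ℕ → S → T) (v : ℕ → ℝ≥0) (h : S → ℝ) (n : ℕ) :
    ∫ x, logSumExp (h + x) ∂(convSeq (fun i => labelLaw (f i) (v i)) n) ≤
      logSumExp h + ∑ i ∈ Finset.range n, (v i : ℝ) / 2 := by
  induction n generalizing h with
  | zero => simp [convSeq]
  | succ n ih =>
    have hi := integrable_convSeq (μ := fun i => labelLaw (f i) (v i))
      (fun i => integrable_labelLaw _ _) n
    rw [convSeq, integral_logSumExp_conv hi (integrable_labelLaw _ _), Finset.sum_range_succ]
    calc _ ≤ ∫ x, (logSumExp (h + x) + (v n : ℝ) / 2)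
            ∂(convSeq (fun i => labelLaw (f i) (v i)) n) :=
          integral_mono (integrable_integral_logSumExp hi (integrable_labelLaw _ _) h)
            ((integrable_logSumExp hi h).add (integrable_const _))
            fun x => integral_logSumExp_labelLaw_le (h + x) (f n) (v n)
      _ ≤ _ := by
          rw [integral_add (integrable_logSumExp hi h) (integrable_const _)]
          have := ih h
          simp
          linarith

/-- The log-partition function of two non-interacting systems is additive. -/
lemma integral_logSumExp_prod {R : Type*} [Fintype R] [Nonempty R]
    {S' : Type*} [Fintype S'] (e : S' ≃ S × R)
    {μ : Measure (S → ℝ)} {ν : Measure (R → ℝ)} [IsProbabilityMeasure μ] [IsProbabilityMeasure ν]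
    (hμ : Integrable (fun x => x) μ) (hν : Integrable (fun x => x) ν) :
    ∫ x, logSumExp x ∂((μ.map fun x s => x (e s).1) ∗ (ν.map fun y s => y (e s).2)) =
      ∫ x, logSumExp x ∂μ + ∫ y, logSumExp y ∂ν := by
  have hne : Nonempty S' := e.nonempty
  have hlse : ∀ (x : S → ℝ) (y : R → ℝ),
      logSumExp ((fun s => x (e s).1) + fun s => y (e s).2) = logSumExp x + logSumExp y := by
    intro x y
    rw [logSumExp, logSumExp, logSumExp,
      ← Real.log_mul (sum_exp_pos x).ne' (sum_exp_pos y).ne', Finset.sum_mul_sum,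
      ← Fintype.sum_prod_type', ← e.sum_comp]
    simp [Real.exp_add]
  have hx : Integrable logSumExp μ := by simpa using integrable_logSumExp hμ 0
  have hy : Integrable logSumExp ν := by simpa using integrable_logSumExp hν 0
  rw [Measure.conv, Measure.map_prod_map _ _ (measurable_comp_label _) (measurable_comp_label _),
    Measure.map_map (by fun_prop)
      ((measurable_comp_label _).prodMap (measurable_comp_label _)),
    integral_map (by
      exact (measurable_fst.add measurable_snd).comp
        ((measurable_comp_label _).prodMap (measurable_comp_label _)) |>.aemeasurable)
      continuous_logSumExp.aestronglyMeasurable]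
  simp only [Function.comp_apply, Prod.map_fst, Prod.map_snd, hlse]
  rw [integral_add (hx.comp_fst ν) (hy.comp_snd μ), integral_fun_fst, integral_fun_snd]
  simp

end Comparison

section Field

variable {C : Type*}

/-- The coordinates of level at most `j` of a configuration. -/
def levelLabel (lam : C → ℕ) (j : ℕ) (σ : C → Bool) : C → Bool :=
  fun c => if lam c ≤ j then σ c else false

lemma levelLabel_eq_iff (lam : C → ℕ) (j : ℕ) (σ τ : C → Bool) :
    levelLabel lam j σ = levelLabel lam j τ ↔ ∀ c, lam c ≤ j → σ c = τ c := by
  rw [funext_iff]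
  refine forall_congr' fun c => ?_
  by_cases h : lam c ≤ j <;> simp [levelLabel, h]

variable [Fintype C]

open Classical in
/-- The variance of the level-`j` contribution to the exponent `-β H`. -/
noncomputable def levelVar (a : ℕ → ℝ) (β : ℝ) (lam : C → ℕ) (j : ℕ) : ℝ≥0 :=
  if ∃ c, lam c = j then (β ^ 2 * Fintype.card C * a j).toNNReal else 0

lemma map_mul_comp_label {S T : Type*} [Fintype T] (f : S → T) (c : ℝ) (v : ℝ≥0) :
    (Measure.pi fun _ : T => gaussianReal 0 v).map (fun g s => c * g (f s)) =
      labelLaw f ((c ^ 2).toNNReal * v) := by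
  have hg : (gaussianReal 0 v).map (c * ·) = gaussianReal 0 ((c ^ 2).toNNReal * v) := by
    rw [gaussianReal_map_const_mul, mul_zero, Real.toNNReal_of_nonneg (sq_nonneg c)]
  have hprob : ∀ _ : T, IsProbabilityMeasure ((gaussianReal 0 v).map (c * ·)) := fun _ =>
    Measure.isProbabilityMeasure_map (by fun_prop)
  rw [labelLaw, ← hg, ← Measure.pi_map_pi (fun _ => by fun_prop),
    Measure.map_map (measurable_comp_label f) (by fun_prop)]
  rfl

lemma gremKnat_eq_sum_range (k : ℕ → ℕ) {n m : ℕ} (hm : m ≤ n) :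
    gremKnat n (fun i => k i) m = ∑ i ∈ Finset.range m, k i := by
  rw [gremKnat, Finset.sum_filter,
    Fin.sum_univ_eq_sum_range (fun i => if i < m then k i else 0) n, ← Finset.sum_filter]
  congr 1
  ext i
  simp
  omega

/-- An enumeration of the coordinates in increasing order of levels. -/
lemma exists_equiv_levels (k : ℕ → ℕ) (n : ℕ) (lam : C → ℕ) (hn : ∀ c, lam c < n)
    (hk : ∀ j < n, Fintype.card {c // lam c = j} = k j) :
    ∃ e : Fin (∑ i : Fin n, k i) ≃ C, ∀ t, ∀ j < n,
      lam (e t) ≤ j ↔ (t : ℕ) < gremKnat n (fun i => k i) (j + 1) := by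
  classical
  let l : C → Fin n := fun c => ⟨lam c, hn c⟩
  have hcard : ∀ j : Fin n, Fintype.card {c // l c = j} = k j := fun j => by
    rw [← hk j j.2]
    exact Fintype.card_congr (Equiv.subtypeEquivRight fun c => by simp [l, Fin.ext_iff])
  let e : C ≃ Fin (∑ i : Fin n, k i) :=
    ((Equiv.sigmaFiberEquiv l).symm.trans
      (Equiv.sigmaCongrRight fun j => Fintype.equivFinOfCardEq (hcard j))).trans finSigmaFinEquiv
  have he : ∀ c, ∃ x : Fin (k (lam c)), (e c : ℕ) = ∑ i ∈ Finset.range (lam c), k i + x := by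
    intro c
    refine ⟨Fintype.equivFinOfCardEq (hcard (l c)) ⟨c, rfl⟩, ?_⟩
    simp only [e, Equiv.trans_apply, finSigmaFinEquiv_apply]
    congr 1
    exact Fin.sum_univ_eq_sum_range k (lam c)
  refine ⟨e.symm, fun t j hj => ?_⟩
  obtain ⟨c, rfl⟩ := e.surjective t
  obtain ⟨x, hx⟩ := he c
  rw [Equiv.symm_apply_apply, gremKnat_eq_sum_range k (by omega), hx]
  constructor
  · intro h
    calc _ < ∑ i ∈ Finset.range (lam c), k i + k (lam c) := by have := x.2; omega
      _ = ∑ i ∈ Finset.range (lam c + 1), k i := (Finset.sum_range_succ _ _).symm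
      _ ≤ _ := Finset.sum_le_sum_of_subset (Finset.range_mono (by omega))
  · intro h
    by_contra! hlt
    have := Finset.sum_le_sum_of_subset (f := k)
      (Finset.range_mono (show j + 1 ≤ lam c by omega))
    omega

variable [DecidableEq C]

/-- The law of the level-`j` contribution to the exponent `-β H`. -/
noncomputable def levelLaw (a : ℕ → ℝ) (β : ℝ) (lam : C → ℕ) (j : ℕ) : Measure ((C → Bool) → ℝ) :=
  labelLaw (levelLabel lam j) (levelVar a β lam j)

/-- The expected log-partition function of the GREM whose spin coordinates `C` are distributed
over the levels by `lam`. -/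
noncomputable def meanLogZ (a : ℕ → ℝ) (β : ℝ) (lam : C → ℕ) (n : ℕ) : ℝ :=
  ∫ x, logSumExp x ∂(convSeq (levelLaw a β lam) n)

instance (a : ℕ → ℝ) (β : ℝ) (lam : C → ℕ) (j : ℕ) :
    IsProbabilityMeasure (levelLaw a β lam j) := by
  rw [levelLaw]; infer_instance

/-- The expected log-partition function depends only on the numbers of coordinates per level. -/
lemma integral_log_gremZ_eq_meanLogZ (a : ℕ → ℝ) (β : ℝ) (k : ℕ → ℕ) (n : ℕ) (lam : C → ℕ)
    (hn : ∀ c, lam c < n) (hk : ∀ j < n, Fintype.card {c // lam c = j} = k j) :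
    ∫ ω, Real.log (gremZ n (fun i => k i) β ω) ∂(gremMeasure n (fun i => k i) fun i => a i) =
      meanLogZ a β lam n := by
  obtain ⟨e, he⟩ := exists_equiv_levels k n lam hn hk
  have hcard : ((∑ i : Fin n, k i : ℕ) : ℝ) = Fintype.card C := by
    rw [← Fintype.card_congr e, Fintype.card_fin]
  have hle : ∀ i : Fin n, gremKnat n (fun i => k i) ((i : ℕ) + 1) ≤ ∑ i : Fin n, k i := fun i =>
    Finset.sum_le_sum_of_subset (Finset.filter_subset _ _)
  let f : (i : Fin n) → (C → Bool) → (Fin (gremKnat n (fun i => k i) ((i : ℕ) + 1)) → Bool) :=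
    fun i τ t => τ (e (Fin.castLE (hle i) t))
  let c : Fin n → ℝ := fun i => if 0 < k i then β * Real.sqrt (Fintype.card C) else 0
  let Ψ : (i : Fin n) → ((Fin (gremKnat n (fun i => k i) ((i : ℕ) + 1)) → Bool) → ℝ) →
    (C → Bool) → ℝ := fun i g τ => c i * g (f i τ)
  have hΨ : ∀ i, Measurable (Ψ i) := fun i =>
    measurable_pi_lambda _ fun τ => (measurable_pi_apply _).const_mul _
  have hZ : ∀ ω, Real.log (gremZ n (fun i => k i) β ω) =
      logSumExp (∑ i, Ψ i (ω i)) := fun ω => by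
    rw [gremZ, logSumExp, ← (e.symm.arrowCongr (Equiv.refl Bool)).sum_comp]
    congr 1
    refine Finset.sum_congr rfl fun τ _ => ?_
    congr 1
    rw [gremH, Finset.sum_filter, Finset.mul_sum, Finset.mul_sum, Finset.sum_apply]
    refine Finset.sum_congr rfl fun i _ => ?_
    have hc : (∑ j : Fin n, ((k j : ℕ) : ℝ)) = Fintype.card C := by
      rw [← hcard]; push_cast; rfl
    by_cases hki : 0 < k i
    · simp only [hki, if_true, Ψ, c, f]
      simp only [Equiv.arrowCongr, hc]
      simp
      ring_nf
    · simp [hki, Ψ, c]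
  have hlaw : ∀ i : Fin n, (Measure.pi fun _ => gaussianReal 0 (a i).toNNReal).map (Ψ i) =
      levelLaw a β lam i := fun i => by
    rw [map_mul_comp_label, levelLaw]
    have hv : ((c i) ^ 2).toNNReal * (a i).toNNReal = levelVar a β lam i := by
      have hpos : (∃ x, lam x = i) ↔ 0 < k i := by
        rw [← hk i i.2, Fintype.card_pos_iff, nonempty_subtype]
      by_cases hki : 0 < k i
      · rw [levelVar, if_pos (hpos.2 hki)]
        simp only [c, hki, if_true]
        rw [← Real.toNNReal_mul (sq_nonneg _), mul_pow, Real.sq_sqrt (Nat.cast_nonneg _)]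
      · rw [levelVar, if_neg (mt hpos.1 hki)]
        simp [c, hki]
    rw [hv]
    refine labelLaw_congr (fun σ τ => ?_) _
    rw [levelLabel_eq_iff, funext_iff]
    constructor
    · intro h x hx
      obtain ⟨t, rfl⟩ := e.surjective x
      exact h ⟨t, (he t i i.2).1 hx⟩
    · intro h t
      exact h _ ((he _ i i.2).2 t.2)
  have hpi : (gremMeasure n (fun i => k i) fun i => a i).map (fun ω (i : Fin n) => Ψ i (ω i)) =
      Measure.pi fun i : Fin n => levelLaw a β lam i := by
    have hprob : ∀ i : Fin n, IsProbabilityMeasure ((Measure.pi fun _ :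
        (Fin (gremKnat n (fun i => k i) ((i : ℕ) + 1)) → Bool) =>
          gaussianReal 0 (a i).toNNReal).map (Ψ i)) := fun i =>
      Measure.isProbabilityMeasure_map (hΨ i).aemeasurable
    rw [gremMeasure, Measure.pi_map_pi fun i => (hΨ i).aemeasurable]
    simp only [hlaw]
  have hΨ' : Measurable fun (ω : GremSample n fun i => k i) i => Ψ i (ω i) :=
    measurable_pi_lambda _ fun i => (hΨ i).comp (measurable_pi_apply i)
  simp only [hZ]
  rw [meanLogZ, ← map_sum_pi, ← hpi, Measure.map_map (by fun_prop) hΨ',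
    integral_map (by
      exact ((by fun_prop : Measurable fun x : Fin n → (C → Bool) → ℝ => ∑ i, x i).comp
        hΨ').aemeasurable) continuous_logSumExp.aestronglyMeasurable]
  rfl

end Field

section MeanLogZ

variable {C : Type*} [Fintype C]

lemma levelVar_le (a : ℕ → ℝ) (ha : ∀ i, 0 ≤ a i) (β : ℝ) (lam : C → ℕ) (j : ℕ) :
    (levelVar a β lam j : ℝ) ≤ β ^ 2 * Fintype.card C * a j := by
  have h : 0 ≤ β ^ 2 * Fintype.card C * a j := by have := ha j; positivity
  rw [levelVar]
  split_ifs
  · rw [Real.coe_toNNReal _ h]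
  · simpa using h

lemma levelVar_add_le {C' : Type*} [Fintype C'] (a : ℕ → ℝ) (ha : ∀ i, 0 ≤ a i) (β : ℝ)
    (lam : C → ℕ) (lam' : C' → ℕ) (j : ℕ) :
    levelVar a β lam j + levelVar a β lam' j ≤ levelVar a β (Sum.elim lam lam') j := by
  by_cases h : ∃ c, Sum.elim lam lam' c = j
  · rw [← NNReal.coe_le_coe, NNReal.coe_add]
    have hj := ha j
    rw [levelVar.eq_def a β (Sum.elim lam lam'), if_pos h, Real.coe_toNNReal _ (by positivity)]
    have h1 := levelVar_le a ha β lam j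
    have h2 := levelVar_le a ha β lam' j
    rw [Fintype.card_sum]
    push_cast
    linarith
  · rw [Sum.exists, not_or] at h
    rw [levelVar.eq_def a β lam, levelVar.eq_def a β lam', if_neg (by simpa using h.1),
      if_neg (by simpa using h.2), add_zero]
    exact zero_le

variable [DecidableEq C]

lemma integrable_levelLaw (a : ℕ → ℝ) (β : ℝ) (lam : C → ℕ) (j : ℕ) :
    Integrable (fun x => x) (levelLaw a β lam j) :=
  integrable_labelLaw _ _

lemma meanLogZ_nonneg (a : ℕ → ℝ) (β : ℝ) (lam : C → ℕ) (n : ℕ) :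
    0 ≤ meanLogZ a β lam n := by
  have h := convSeq_lseLE (μ := fun _ => Measure.dirac 0) (ν := levelLaw a β lam)
    (fun _ => integrable_dirac (by simp)) (integrable_levelLaw a β lam)
    (fun j => dirac_lseLE_labelLaw _ _) n 0
  rw [convSeq_eq_of_le _ (Nat.zero_le n) fun _ _ => rfl] at h
  simp only [convSeq, integral_dirac, zero_add] at h
  refine le_trans ?_ h
  rw [logSumExp]
  simpa using Real.log_natCast_nonneg (2 ^ Fintype.card C)

lemma meanLogZ_le (a : ℕ → ℝ) (ha : ∀ i, 0 ≤ a i) (hasummable : Summable a)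
    (hasum : ∑' i, a i = 1) (β : ℝ) (lam : C → ℕ) (n : ℕ) :
    meanLogZ a β lam n ≤ Fintype.card C * (Real.log 2 + β ^ 2 / 2) := by
  have h := integral_logSumExp_convSeq_le (levelLabel lam) (levelVar a β lam) 0 n
  have h0 : logSumExp (0 : (C → Bool) → ℝ) = Fintype.card C * Real.log 2 := by
    simp [logSumExp]
  have hs : ∑ i ∈ Finset.range n, (levelVar a β lam i : ℝ) / 2 ≤
      β ^ 2 * Fintype.card C / 2 * 1 := by
    calc _ ≤ ∑ i ∈ Finset.range n, β ^ 2 * Fintype.card C / 2 * a i :=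
          Finset.sum_le_sum fun i _ => by linarith [levelVar_le a ha β lam i]
      _ = β ^ 2 * Fintype.card C / 2 * ∑ i ∈ Finset.range n, a i := (Finset.mul_sum ..).symm
      _ ≤ _ := by
          gcongr
          exact (hasummable.sum_le_tsum _ fun i _ => ha i).trans_eq hasum
  simp only [zero_add, h0] at h
  rw [meanLogZ]
  refine h.trans ?_
  linarith

lemma meanLogZ_eq_of_le (a : ℕ → ℝ) (β : ℝ) (lam : C → ℕ) {m n : ℕ} (hmn : m ≤ n)
    (hm : ∀ c, lam c < m) : meanLogZ a β lam n = meanLogZ a β lam m := by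
  rw [meanLogZ, meanLogZ, convSeq_eq_of_le _ hmn fun j hj => ?_]
  rw [levelLaw, levelVar, if_neg, labelLaw_zero]
  rintro ⟨c, rfl⟩
  exact (hm c).not_ge hj

variable {C' : Type*} [Fintype C'] [DecidableEq C']

/-- The expected log-partition function is super-additive under disjoint unions. -/
lemma meanLogZ_add_le (a : ℕ → ℝ) (ha : ∀ i, 0 ≤ a i) (β : ℝ) (lam : C → ℕ) (lam' : C' → ℕ)
    (n : ℕ) : meanLogZ a β lam n + meanLogZ a β lam' n ≤ meanLogZ a β (Sum.elim lam lam') n := by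
  let e := Equiv.sumArrowEquivProdArrow C C' Bool
  let L : ((C → Bool) → ℝ) →+ ((C ⊕ C' → Bool) → ℝ) :=
    { toFun := fun x s => x (e s).1, map_zero' := rfl, map_add' := fun _ _ => rfl }
  let L' : ((C' → Bool) → ℝ) →+ ((C ⊕ C' → Bool) → ℝ) :=
    { toFun := fun x s => x (e s).2, map_zero' := rfl, map_add' := fun _ _ => rfl }
  have hL := map_convSeq (levelLaw a β lam) L (measurable_comp_label _) n
  have hL' := map_convSeq (levelLaw a β lam') L' (measurable_comp_label _) n
  have hlaw : ∀ j, (levelLaw a β lam j).map L =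
      labelLaw (fun s => levelLabel lam j (e s).1) (levelVar a β lam j) := fun j =>
    map_labelLaw_comp _ (fun s => (e s).1) _
  have hlaw' : ∀ j, (levelLaw a β lam' j).map L' =
      labelLaw (fun s => levelLabel lam' j (e s).2) (levelVar a β lam' j) := fun j =>
    map_labelLaw_comp _ (fun s => (e s).2) _
  rw [meanLogZ, meanLogZ, ← integral_logSumExp_prod e
    (integrable_convSeq (integrable_levelLaw a β lam) n)
    (integrable_convSeq (integrable_levelLaw a β lam') n)]
  change ∫ x, logSumExp x ∂((convSeq (levelLaw a β lam) n).map L ∗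
    (convSeq (levelLaw a β lam') n).map L') ≤ _
  simp only [hL, hL', hlaw, hlaw']
  rw [← convSeq_conv]
  have key : ∀ j, LseLE (labelLaw (fun s => levelLabel lam j (e s).1) (levelVar a β lam j) ∗
      labelLaw (fun s => levelLabel lam' j (e s).2) (levelVar a β lam' j))
      (levelLaw a β (Sum.elim lam lam') j) := fun j => by
    refine LseLE.trans ?_ (labelLaw_mono _ (levelVar_add_le a ha β lam lam' j))
    rw [labelLaw_add]
    refine LseLE.conv (integrable_labelLaw _ _) (integrable_labelLaw _ _)
      (integrable_labelLaw _ _) (integrable_labelLaw _ _)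
      (labelLaw_merge _ _ (fun σ τ h => ?_) _) (labelLaw_merge _ _ (fun σ τ h => ?_) _)
    · rw [levelLabel_eq_iff] at h ⊢
      exact fun c hc => h (Sum.inl c) hc
    · rw [levelLabel_eq_iff] at h ⊢
      exact fun c hc => h (Sum.inr c) hc
  have h := convSeq_lseLE (fun j => integrable_conv (integrable_labelLaw _ _)
    (integrable_labelLaw _ _)) (integrable_levelLaw a β _) key n 0
  simpa only [zero_add, meanLogZ] using h

end MeanLogZ

section Sequence

lemma meanLogZ_eq {C : Type*} [Fintype C] [DecidableEq C] (a : ℕ → ℝ) (β : ℝ) (lam : C → ℕ)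
    {m n : ℕ} (hm : ∀ c, lam c < m) (hn : ∀ c, lam c < n) :
    meanLogZ a β lam n = meanLogZ a β lam m := by
  rcases le_total m n with h | h
  · exact meanLogZ_eq_of_le a β lam h hm
  · exact (meanLogZ_eq_of_le a β lam h hn).symm

lemma card_sigma_fiber (k : ℕ → ℕ) (n j : ℕ) :
    Fintype.card {c : Σ i : Fin n, Fin (k i) // (c.1 : ℕ) = j} = if j < n then k j else 0 := by
  rw [Fintype.card_subtype, Finset.card_filter, Fintype.sum_sigma]
  have h : ∀ i : Fin n, (∑ _x : Fin (k i), if (i : ℕ) = j then 1 else 0) =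
      if (i : ℕ) = j then k i else 0 := fun i => by split_ifs <;> simp
  refine (Finset.sum_congr rfl fun i _ => ?_).trans
    ((Fin.sum_univ_eq_sum_range (fun i => if i = j then k i else 0) n).trans ?_)
  · convert h i
  · simp

lemma card_sum_fiber {C C' : Type*} [Fintype C] [Fintype C'] (lam : C → ℕ) (lam' : C' → ℕ)
    (j : ℕ) : Fintype.card {c // Sum.elim lam lam' c = j} =
      Fintype.card {c // lam c = j} + Fintype.card {c // lam' c = j} := by
  rw [Fintype.card_subtype, Fintype.card_subtype, Fintype.card_subtype, Finset.card_filter,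
    Finset.card_filter, Finset.card_filter, Fintype.sum_sum_type]
  rfl

variable {alpha a : ℕ → ℝ}

lemma gremSeqK_le (halpha : ∀ i, 1 < alpha i) (N i : ℕ) :
    (gremSeqK alpha N i : ℝ) ≤ N * (Real.log (alpha i) / Real.log 2) := by
  have h := Real.log_pos (halpha i)
  have h2 := Real.log_pos (one_lt_two)
  rw [← mul_div_assoc]
  exact Nat.floor_le (by positivity)

lemma gremSeqK_add_le (halpha : ∀ i, 1 < alpha i) (N M i : ℕ) :
    gremSeqK alpha N i + gremSeqK alpha M i ≤ gremSeqK alpha (N + M) i := by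
  refine Nat.le_floor ?_
  have hN := gremSeqK_le halpha N i
  have hM := gremSeqK_le halpha M i
  push_cast
  rw [mul_div_assoc, add_mul]
  exact add_le_add hN hM

lemma lt_gremSeqLevels (hlog : Summable fun i => Real.log (alpha i)) {N i : ℕ}
    (h : 0 < gremSeqK alpha N i) : i < gremSeqLevels alpha N := by
  refine Nat.lt_succ_of_le (le_csSup ?_ h)
  have h0 : Tendsto (fun i => (N : ℝ) * Real.log (alpha i) / Real.log 2) atTop (𝓝 0) := by
    simpa using (hlog.tendsto_atTop_zero.const_mul (N : ℝ)).div_const (Real.log 2)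
  obtain ⟨B, hB⟩ := eventually_atTop.1 (h0.eventually_lt_const one_pos)
  refine ⟨B, fun j hj => ?_⟩
  by_contra! hlt
  have := hB j hlt.le
  exact hj.ne' (Nat.floor_eq_zero.2 this)

/-- The level of each coordinate of the `N`-th model of the sequence. -/
def seqLabel (alpha : ℕ → ℝ) (N : ℕ)
    (c : Σ i : Fin (gremSeqLevels alpha N), Fin (gremSeqK alpha N i)) : ℕ :=
  c.1

lemma card_seqLabel_fiber (hlog : Summable fun i => Real.log (alpha i)) (N j : ℕ) :
    Fintype.card {c // seqLabel alpha N c = j} = gremSeqK alpha N j := by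
  refine (card_sigma_fiber (gremSeqK alpha N) _ j).trans ?_
  split_ifs with h
  · rfl
  · exact (Nat.eq_zero_of_not_pos fun h' => h (lt_gremSeqLevels hlog h')).symm

lemma gremSeqAlpha_eq {C : Type*} [Fintype C] [DecidableEq C] (β : ℝ) (N : ℕ)
    (lam : C → ℕ) (hn : ∀ c, lam c < gremSeqLevels alpha N)
    (hk : ∀ j < gremSeqLevels alpha N, Fintype.card {c // lam c = j} = gremSeqK alpha N j) :
    gremSeqAlpha alpha a β N = -meanLogZ a β lam (gremSeqLevels alpha N) := by
  rw [gremSeqAlpha, ← integral_log_gremZ_eq_meanLogZ a β (gremSeqK alpha N) _ lam hn hk]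

lemma gremSeqAlpha_eq_of_lt (hlog : Summable fun i => Real.log (alpha i)) (β : ℝ) (N : ℕ) {n : ℕ}
    (hn : ∀ c, seqLabel alpha N c < n) :
    gremSeqAlpha alpha a β N = -meanLogZ a β (seqLabel alpha N) n := by
  have hlt : ∀ c, seqLabel alpha N c < gremSeqLevels alpha N := fun c => c.1.2
  rw [gremSeqAlpha_eq β N (seqLabel alpha N) hlt fun j _ => card_seqLabel_fiber hlog N j,
    meanLogZ_eq a β _ hn hlt]

lemma subadditive_gremSeqAlpha (halpha : ∀ i, 1 < alpha i)
    (hlog : Summable fun i => Real.log (alpha i)) (ha : ∀ i, 0 ≤ a i) (β : ℝ) :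
    Subadditive (gremSeqAlpha alpha a β) := by
  intro N M
  have hlt : ∀ {N' : ℕ}, (∀ i, gremSeqK alpha N' i ≤ gremSeqK alpha (N + M) i) →
      ∀ c, seqLabel alpha N' c < gremSeqLevels alpha (N + M) := fun h c =>
    lt_gremSeqLevels hlog (((Nat.zero_le _).trans_lt c.2.2).trans_le (h _))
  have hN := hlt fun i => (Nat.le_add_right _ _).trans (gremSeqK_add_le halpha N M i)
  have hM := hlt fun i => (Nat.le_add_left _ _).trans (gremSeqK_add_le halpha N M i)
  let r : ℕ → ℕ := fun i => gremSeqK alpha (N + M) i - (gremSeqK alpha N i + gremSeqK alpha M i)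
  let lam : (Σ i : Fin (gremSeqLevels alpha (N + M)), Fin (r i)) → ℕ := fun c => c.1
  rw [gremSeqAlpha_eq_of_lt hlog β N hN, gremSeqAlpha_eq_of_lt hlog β M hM,
    gremSeqAlpha_eq β (N + M) (Sum.elim (Sum.elim (seqLabel alpha N) (seqLabel alpha M)) lam)]
  · have h1 := meanLogZ_add_le a ha β (seqLabel alpha N) (seqLabel alpha M)
      (gremSeqLevels alpha (N + M))
    have h2 := meanLogZ_add_le a ha β (Sum.elim (seqLabel alpha N) (seqLabel alpha M)) lam
      (gremSeqLevels alpha (N + M))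
    have h3 := meanLogZ_nonneg a β lam (gremSeqLevels alpha (N + M))
    linarith
  · rintro ((c | c) | c)
    exacts [hN c, hM c, c.1.2]
  · intro j hj
    rw [card_sum_fiber, card_sum_fiber, card_seqLabel_fiber hlog, card_seqLabel_fiber hlog,
      card_sigma_fiber, if_pos hj]
    have := gremSeqK_add_le halpha N M j
    simp only [r]
    omega

lemma neg_le_gremSeqAlpha (halpha : ∀ i, 1 < alpha i)
    (hlog : Summable fun i => Real.log (alpha i))
    (hlogsum : ∑' i, Real.log (alpha i) = Real.log 2) (ha : ∀ i, 0 ≤ a i)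
    (hasummable : Summable a) (hasum : ∑' i, a i = 1) (β : ℝ) (N : ℕ) :
    -(N * (Real.log 2 + β ^ 2 / 2)) ≤ gremSeqAlpha alpha a β N := by
  rw [gremSeqAlpha_eq_of_lt hlog β N fun c => c.1.2, neg_le_neg_iff]
  refine (meanLogZ_le a ha hasummable hasum β _ _).trans ?_
  have h2 := Real.log_pos (one_lt_two)
  refine mul_le_mul_of_nonneg_right ?_ (by positivity)
  have hc : Fintype.card (Σ i : Fin (gremSeqLevels alpha N), Fin (gremSeqK alpha N i)) =
      ∑ i ∈ Finset.range (gremSeqLevels alpha N), gremSeqK alpha N i := by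
    simp [Finset.sum_range]
  rw [hc]
  push_cast
  calc _ ≤ ∑ i ∈ Finset.range (gremSeqLevels alpha N),
          (N : ℝ) * (Real.log (alpha i) / Real.log 2) :=
        Finset.sum_le_sum fun i _ => gremSeqK_le halpha N i
    _ = N * ((∑ i ∈ Finset.range (gremSeqLevels alpha N), Real.log (alpha i)) / Real.log 2) := by
        rw [← Finset.mul_sum, Finset.sum_div]
    _ ≤ N * 1 := by
        gcongr
        rw [div_le_one h2, ← hlogsum]
        exact hlog.sum_le_tsum _ fun i _ => (Real.log_pos (halpha i)).le
    _ = N := mul_one _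

lemma tendsto_gremSeqKtot_div (halpha : ∀ i, 1 < alpha i)
    (hlog : Summable fun i => Real.log (alpha i))
    (hlogsum : ∑' i, Real.log (alpha i) = Real.log 2) :
    Tendsto (fun N : ℕ => gremSeqKtot alpha N / N) atTop (𝓝 1) := by
  have h2 := Real.log_pos (one_lt_two)
  have hsum : ∑' i, Real.log (alpha i) / Real.log 2 = 1 := by
    rw [tsum_div_const, hlogsum, div_self h2.ne']
  rw [← hsum]
  simp only [gremSeqKtot, ← tsum_div_const]
  refine tendsto_tsum_of_dominated_convergence (hlog.div_const (Real.log 2)) (fun i => ?_)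
    (eventually_gt_atTop 0 |>.mono fun N hN i => ?_)
  · have hx : 0 ≤ Real.log (alpha i) / Real.log 2 := div_nonneg (Real.log_pos (halpha i)).le h2.le
    refine ((tendsto_nat_floor_mul_div_atTop hx).comp tendsto_natCast_atTop_atTop).congr fun N => ?_
    simp only [Function.comp_apply, gremSeqK]
    congr 3
    ring
  · have hN' : (0 : ℝ) < N := by exact_mod_cast hN
    rw [Real.norm_of_nonneg (by positivity), div_le_iff₀' hN']
    exact gremSeqK_le halpha N i

end Sequence

end Grem

/-- **Thermodynamic limit for the GREM with infinitely many levels**: for every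
`β > 0`, the quenched free energy per site `−(1/(β|k(N)|)) E[log Z_{k(N)}(β)]`
converges as `N → ∞` to the (finite) infimum `inf_N α_N(β)/(βN)`. -/
theorem grem_seq_thermodynamic_limit (alpha a : ℕ → ℝ)
    (halpha : ∀ i, 1 < alpha i)
    (hlogsummable : Summable fun i => Real.log (alpha i))
    (hlogsum : ∑' i, Real.log (alpha i) = Real.log 2)
    (ha : ∀ i, 0 < a i) (hasummable : Summable a) (hasum : ∑' i, a i = 1)
    (β : ℝ) (hβ : 0 < β) :
    Filter.Tendsto
      (fun N : ℕ => gremSeqAlpha alpha a β N / (β * gremSeqKtot alpha N))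
      Filter.atTop
      (nhds (⨅ N : ℕ+, gremSeqAlpha alpha a β N / (β * (N : ℝ)))) := by
  have hsub : Subadditive fun N => gremSeqAlpha alpha a β N / β := fun N M => by
    rw [← add_div]
    exact div_le_div_of_nonneg_right (Grem.subadditive_gremSeqAlpha halpha hlogsummable
      (fun i => (ha i).le) β N M) hβ.le
  have hbdd : BddBelow (Set.range fun N : ℕ => gremSeqAlpha alpha a β N / β / N) := by
    refine ⟨-((Real.log 2 + β ^ 2 / 2) / β), ?_⟩
    rintro _ ⟨N, rfl⟩
    have h2 := Real.log_pos (one_lt_two)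
    rcases N.eq_zero_or_pos with rfl | hN
    · simp only [Nat.cast_zero, div_zero, Left.neg_nonpos_iff]
      positivity
    · have hN' : (0 : ℝ) < N := by exact_mod_cast hN
      beta_reduce
      rw [div_div, le_div_iff₀ (by positivity)]
      refine le_trans (le_of_eq ?_) (Grem.neg_le_gremSeqAlpha halpha hlogsummable hlogsum
        (fun i => (ha i).le) hasummable hasum β N)
      field_simp
  have hlim : hsub.lim = ⨅ N : ℕ+, gremSeqAlpha alpha a β N / (β * (N : ℝ)) := by
    rw [Subadditive.lim, iInf]
    congr 1
    ext x
    simp only [Set.mem_image, Set.mem_Ici, Set.mem_range, div_div]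
    exact ⟨fun ⟨N, hN, h⟩ => ⟨⟨N, hN⟩, h⟩, fun ⟨N, h⟩ => ⟨N, N.2, h⟩⟩
  have h := (hsub.tendsto_lim hbdd).div
    (Grem.tendsto_gremSeqKtot_div halpha hlogsummable hlogsum) one_ne_zero
  rw [hlim, div_one] at h
  refine h.congr' ?_
  filter_upwards [eventually_gt_atTop 0] with N hN
  have hN' : (N : ℝ) ≠ 0 := by exact_mod_cast hN.ne'
  simp only [Pi.div_apply]
  rw [div_div_div_cancel_right₀ hN', div_div]
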